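/- Let (Q, P) : ℝ × ℝ → ℝᵈ × ℝᵈ be a C² map such that for every s the curve t ↦ (Q(t,s), P(t,s)) solves Hamilton's equations ∂_t Q(t,s) = ∇_p H(t, Q(t,s), P(t,s)) and ∂_t P(t,s) = −∇_q H(t, Q(t,s), P(t,s)), and such that (Q, P)(t, s+1) = (Q, P)(t, s) for all (t,s). Then the Poincaré invariant t ↦ ∫₀¹ P(t,s) · ∂_s Q(t,s) ds is constant in t. -/

import Mathlib

open scoped BigOperators

/-- If the vector field `(F, G)` on the plane is divergence-free and `G` takes the same values on the
lines `s = a` and `s = b`, then the flux of `F` through `{t} × [a, b]` does not depend on `t`. -/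
lemma intervalIntegral_eq_of_divergence_eq_zero {F G : ℝ × ℝ → ℝ} {F' G' : ℝ × ℝ → ℝ × ℝ →L[ℝ] ℝ}
    (hF : ∀ x, HasFDerivAt F (F' x) x) (hG : ∀ x, HasFDerivAt G (G' x) x)
    (hdiv : ∀ x, F' x (1, 0) + G' x (0, 1) = 0) {a b : ℝ} (hab : ∀ t, G (t, b) = G (t, a))
    (t t' : ℝ) : ∫ s in a..b, F (t, s) = ∫ s in a..b, F (t', s) := by
  have hFc : Continuous F := continuous_iff_continuousAt.2 fun x => (hF x).continuousAt
  have hGc : Continuous G := continuous_iff_continuousAt.2 fun x => (hG x).continuousAt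
  have h := MeasureTheory.integral2_divergence_prod_of_hasFDerivAt F G F' G' t a t' b
    hFc.continuousOn hGc.continuousOn (fun x _ => hF x) (fun x _ => hG x)
    (by simp [hdiv])
  simp only [hdiv, hab, intervalIntegral.integral_zero] at h
  linarith

section NormedSpace

variable {E : Type*} [NormedAddCommGroup E] [NormedSpace ℝ E]

lemma hasFDerivAt_mul_fderiv_apply {f g : E → ℝ} (hf : ContDiff ℝ 2 f) (hg : ContDiff ℝ 2 g)
    (v x : E) :
    HasFDerivAt (fun y => f y * fderiv ℝ g y v)
      (f x • (fderiv ℝ (fderiv ℝ g) x).flip v + fderiv ℝ g x v • fderiv ℝ f x) x := by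
  have hg' : HasFDerivAt (fderiv ℝ g) (fderiv ℝ (fderiv ℝ g) x) x :=
    ((hg.fderiv_right (m := 1) (by norm_num)).differentiable one_ne_zero x).hasFDerivAt
  have hv : HasFDerivAt (fun y => fderiv ℝ g y v) ((fderiv ℝ (fderiv ℝ g) x).flip v) x :=
    (hg'.clm_apply (hasFDerivAt_const v x)).congr_fderiv (by ext w; simp)
  exact (hf.differentiable two_ne_zero x).hasFDerivAt.mul hv

lemma ContDiff.fderiv_fderiv_comm {g : E → ℝ} (hg : ContDiff ℝ 2 g) (x v w : E) :
    fderiv ℝ (fderiv ℝ g) x v w = fderiv ℝ (fderiv ℝ g) x w v :=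
  hg.contDiffAt.isSymmSndFDerivAt (by simp) v w

end NormedSpace

lemma ContinuousLinearMap.apply_zero_prod_pi {d : ℕ}
    (L : ℝ × (Fin d → ℝ) × (Fin d → ℝ) →L[ℝ] ℝ) (u v : Fin d → ℝ) :
    L (0, u, v) = ∑ i, (u i * L (0, Pi.single i 1, 0) + v i * L (0, 0, Pi.single i 1)) := by
  have hu : (0, u, v) = ∑ i, (u i • ((0 : ℝ), (Pi.single i 1 : Fin d → ℝ), (0 : Fin d → ℝ))
      + v i • ((0 : ℝ), (0 : Fin d → ℝ), (Pi.single i 1 : Fin d → ℝ))) := by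
    ext j <;> simp [Prod.fst_sum, Prod.snd_sum, Finset.sum_apply, Pi.single_apply]
  rw [hu, map_sum]
  simp only [map_add, map_smul, smul_eq_mul]

lemma hasDerivAt_comp_prodMk_left {V : Type*} [NormedAddCommGroup V] [NormedSpace ℝ V]
    {f : ℝ × ℝ → V} {f' : ℝ × ℝ →L[ℝ] V} {t s : ℝ} (hf : HasFDerivAt f f' (t, s)) :
    HasDerivAt (fun τ => f (τ, s)) (f' (1, 0)) t :=
  hf.comp_hasDerivAt t ((hasDerivAt_id t).prodMk (hasDerivAt_const t s))

lemma hasDerivAt_comp_prodMk_right {V : Type*} [NormedAddCommGroup V] [NormedSpace ℝ V]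
    {f : ℝ × ℝ → V} {f' : ℝ × ℝ →L[ℝ] V} {t s : ℝ} (hf : HasFDerivAt f f' (t, s)) :
    HasDerivAt (fun σ => f (t, σ)) (f' (0, 1)) s :=
  hf.comp_hasDerivAt s ((hasDerivAt_const s t).prodMk (hasDerivAt_id s))

/-- constancy of the Poincaré invariant: if `(Q,P)(·,s)` is a loop of
solutions of Hamilton's equations for a C² Hamiltonian `H(t,q,p)`, periodic in `s`
with period 1, then `t ↦ ∫₀¹ P(t,s) · ∂ₛQ(t,s) ds` is constant in `t`. -/
theorem stmt8 {d : ℕ}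
    (H : ℝ × (Fin d → ℝ) × (Fin d → ℝ) → ℝ) (hH : ContDiff ℝ 2 H)
    (Q P : ℝ × ℝ → Fin d → ℝ)
    (hQP : ContDiff ℝ 2 (fun p : ℝ × ℝ => (Q p, P p)))
    (hHamQ : ∀ (t s : ℝ) (i : Fin d),
      deriv (fun τ => Q (τ, s)) t i
        = fderiv ℝ H (t, Q (t, s), P (t, s)) (0, 0, Pi.single i 1))
    (hHamP : ∀ (t s : ℝ) (i : Fin d),
      deriv (fun τ => P (τ, s)) t i
        = -fderiv ℝ H (t, Q (t, s), P (t, s)) (0, Pi.single i 1, 0))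
    (hper : ∀ t s : ℝ, Q (t, s + 1) = Q (t, s) ∧ P (t, s + 1) = P (t, s)) :
    ∀ t t' : ℝ,
      (∫ s in (0:ℝ)..1, ∑ i : Fin d, P (t, s) i * deriv (fun σ => Q (t, σ)) s i)
        = ∫ s in (0:ℝ)..1, ∑ i : Fin d, P (t', s) i * deriv (fun σ => Q (t', σ)) s i := by
  have hQ : ContDiff ℝ 2 Q := contDiff_fst.comp hQP
  have hP : ContDiff ℝ 2 P := contDiff_snd.comp hQP
  have hQi : ∀ i, ContDiff ℝ 2 fun x => Q x i := contDiff_pi.1 hQ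
  have hPi : ∀ i, ContDiff ℝ 2 fun x => P x i := contDiff_pi.1 hP
  have hQ' : ∀ x, HasFDerivAt Q (fderiv ℝ Q x) x := fun x =>
    (hQ.differentiable two_ne_zero x).hasFDerivAt
  have hP' : ∀ x, HasFDerivAt P (fderiv ℝ P x) x := fun x =>
    (hP.differentiable two_ne_zero x).hasFDerivAt
  have hQi' : ∀ i x v, fderiv ℝ (fun y => Q y i) x v = fderiv ℝ Q x v i := fun i x v => by
    rw [(hasFDerivAt_pi'.1 (hQ' x) i).fderiv]; rfl
  have hPi' : ∀ i x v, fderiv ℝ (fun y => P y i) x v = fderiv ℝ P x v i := fun i x v => by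
    rw [(hasFDerivAt_pi'.1 (hP' x) i).fderiv]; rfl
  have hQt : ∀ x i, fderiv ℝ Q x (1, 0) i = fderiv ℝ H (x.1, Q x, P x) (0, 0, Pi.single i 1) := by
    rintro ⟨t, s⟩ i
    rw [← hHamQ, (hasDerivAt_comp_prodMk_left (hQ' (t, s))).deriv]
  have hPt : ∀ x i, fderiv ℝ P x (1, 0) i =
      -fderiv ℝ H (x.1, Q x, P x) (0, Pi.single i 1, 0) := by
    rintro ⟨t, s⟩ i
    rw [← hHamP, (hasDerivAt_comp_prodMk_left (hP' (t, s))).deriv]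
  have hHφ : ∀ x, HasFDerivAt (fun y : ℝ × ℝ => H (y.1, Q y, P y))
      ((fderiv ℝ H (x.1, Q x, P x)).comp
        ((ContinuousLinearMap.fst ℝ ℝ ℝ).prod ((fderiv ℝ Q x).prod (fderiv ℝ P x)))) x := fun x =>
    (hH.differentiable two_ne_zero _).hasFDerivAt.comp x
      (hasFDerivAt_fst.prodMk ((hQ' x).prodMk (hP' x)))
  have hsum : ∀ v x, HasFDerivAt (fun y => ∑ i, P y i * fderiv ℝ (fun z => Q z i) y v) _ x :=
    fun v x => HasFDerivAt.fun_sum fun i _ => hasFDerivAt_mul_fderiv_apply (hPi i) (hQi i) v x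
  intro t t'
  simp only [fun t s => (hasDerivAt_comp_prodMk_right (hQ' (t, s))).deriv, ← hQi']
  refine intervalIntegral_eq_of_divergence_eq_zero (hsum (0, 1))
    (fun x => (hHφ x).fun_sub (hsum (1, 0) x)) (fun x => ?_) (fun t => ?_) t t'
  · have hsymm := fun i => (hQi i).fderiv_fderiv_comm x (0, 1) (1, 0)
    simp only [sub_apply, sum_apply, add_apply, smul_apply, smul_eq_mul,
      ContinuousLinearMap.flip_apply, ContinuousLinearMap.comp_apply,
      ContinuousLinearMap.prod_apply, ContinuousLinearMap.coe_fst', hsymm, hQi', hPi']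
    rw [ContinuousLinearMap.apply_zero_prod_pi, ← Finset.sum_sub_distrib, ← Finset.sum_add_distrib]
    exact Finset.sum_eq_zero fun i _ => by rw [hQt, hPt]; ring
  · have h := hper t 0
    rw [zero_add] at h
    simp only [hQi', hQt, h.1, h.2]
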